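/- arXiv:1801.02358 — 3 statements merged into one kernel-verified Lean document; each statement's English description precedes it below -/
import Mathlib

section
/- Let λ > 0, ξ > 1/2, and let u ∈ ℝⁿ with ‖u‖_∞ = λ. Define D₁ = B_n^{(∞)}(ξλ) ∩ B_n^{(∞)}(−u, ξλ) and D₂ = B_n^{(∞)}(ξλ) ∩ B_n^{(∞)}(u, ξλ). Then the probability q that a uniformly random point of B_n^{(∞)}(ξλ) lies in D₁ ∪ D₂ satisfies q ≥ (1 − 1/(2ξ))ⁿ; equivalently, vol(D₁ ∪ D₂) ≥ (1 − 1/(2ξ))ⁿ · (2ξλ)ⁿ. -/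
open MeasureTheory Metric Set

/-- The intersection of two balls of the same radius contains the ball around the midpoint of the
centers whose radius is smaller by half the distance of the centers. -/
theorem closedBall_half_subset_inter {E : Type*} [NormedAddCommGroup E] [NormedSpace ℝ E]
    (u : E) (r : ℝ) :
    closedBall ((1 / 2 : ℝ) • u) (r - ‖u‖ / 2) ⊆ closedBall 0 r ∩ closedBall u r := by
  have hnorm : ‖(1 / 2 : ℝ) • u‖ = ‖u‖ / 2 := by
    rw [norm_smul]
    norm_num
    ring
  refine subset_inter (closedBall_subset_closedBall' ?_) (closedBall_subset_closedBall' ?_)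
  · rw [dist_zero_right, hnorm]
    linarith
  · have hsub : (1 / 2 : ℝ) • u - u = -((1 / 2 : ℝ) • u) := by module
    rw [dist_eq_norm, hsub, norm_neg, hnorm]
    linarith

/-- For `λ > 0`, `ξ > 1/2` and `u ∈ ℝⁿ` with `‖u‖_∞ = λ`, setting
`D₁ = B_n^{(∞)}(ξλ) ∩ B_n^{(∞)}(-u, ξλ)` and `D₂ = B_n^{(∞)}(ξλ) ∩ B_n^{(∞)}(u, ξλ)`,
we have `vol(D₁ ∪ D₂) ≥ (1 - 1/(2ξ))ⁿ (2ξλ)ⁿ`; equivalently the probability `q` that a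
uniform point of `B_n^{(∞)}(ξλ)` lies in `D₁ ∪ D₂`, namely `vol(D₁ ∪ D₂)/(2ξλ)ⁿ`,
satisfies `q ≥ (1 - 1/(2ξ))ⁿ`.
Here `Fin n → ℝ` carries the sup (ℓ∞) norm and `volume` is Lebesgue measure. -/
theorem stmt9 (n : ℕ) (lam ξ : ℝ) (hlam : 0 < lam) (hξ : 1 / 2 < ξ)
    (u : Fin n → ℝ) (hu : ‖u‖ = lam) :
    ENNReal.ofReal ((1 - 1 / (2 * ξ)) ^ n * (2 * ξ * lam) ^ n) ≤
      volume ((closedBall (0 : Fin n → ℝ) (ξ * lam) ∩ closedBall (-u) (ξ * lam)) ∪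
        (closedBall (0 : Fin n → ℝ) (ξ * lam) ∩ closedBall u (ξ * lam))) ∧
    ENNReal.ofReal ((1 - 1 / (2 * ξ)) ^ n) ≤
      volume ((closedBall (0 : Fin n → ℝ) (ξ * lam) ∩ closedBall (-u) (ξ * lam)) ∪
          (closedBall (0 : Fin n → ℝ) (ξ * lam) ∩ closedBall u (ξ * lam))) /
        ENNReal.ofReal ((2 * ξ * lam) ^ n) := by
  have hr : 0 < 2 * ξ * lam := by nlinarith
  have hvol : ENNReal.ofReal ((1 - 1 / (2 * ξ)) ^ n * (2 * ξ * lam) ^ n) ≤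
      volume ((closedBall (0 : Fin n → ℝ) (ξ * lam) ∩ closedBall (-u) (ξ * lam)) ∪
        (closedBall (0 : Fin n → ℝ) (ξ * lam) ∩ closedBall u (ξ * lam))) := by
    have hside : (1 - 1 / (2 * ξ)) * (2 * ξ * lam) = 2 * (ξ * lam - ‖u‖ / 2) := by
      rw [hu]
      field_simp
    have hrad : 0 ≤ ξ * lam - ‖u‖ / 2 := by
      rw [hu]
      nlinarith
    calc ENNReal.ofReal ((1 - 1 / (2 * ξ)) ^ n * (2 * ξ * lam) ^ n)
        = volume (closedBall ((1 / 2 : ℝ) • u) (ξ * lam - ‖u‖ / 2)) := by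
          rw [Real.volume_pi_closedBall _ hrad, Fintype.card_fin, ← mul_pow, hside]
      _ ≤ _ := measure_mono
          ((closedBall_half_subset_inter u (ξ * lam)).trans subset_union_right)
  refine ⟨hvol, ?_⟩
  have hpow : 0 < (2 * ξ * lam) ^ n := pow_pos hr n
  rw [ENNReal.le_div_iff_mul_le (Or.inl (ENNReal.ofReal_pos.2 hpow).ne')
    (Or.inl ENNReal.ofReal_ne_top), ← ENNReal.ofReal_mul' hpow.le]
  exact hvol
end

section
/- Let d > 0, τ > 0, and ξ > max(1/2, τ/4). Let z ∈ ℝⁿ with ‖z‖_∞ ≤ d and set u = (z, −τd/2) ∈ ℝ^{n+1}. Then the probability q that a uniformly random point of the (n+1)-dimensional ℓ∞ ball B_{n+1}^{(∞)}(ξd) lies in D₁ ∪ D₂, where D₁ = B_{n+1}^{(∞)}(ξd) ∩ B_{n+1}^{(∞)}(−u, ξd) and D₂ = B_{n+1}^{(∞)}(ξd) ∩ B_{n+1}^{(∞)}(u, ξd), satisfies q ≥ (1 − 1/(2ξ))ⁿ · (1 − τ/(4ξ)). -/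
open MeasureTheory Metric Set

/-- Two closed sup-norm balls of radius `r` centred at `0` and `u` meet in a box with side lengths
`2 * r - |u i|`. -/
lemma volume_closedBall_zero_inter_closedBall_pi {ι : Type*} [Fintype ι] {r : ℝ} (hr : 0 ≤ r)
    (u : ι → ℝ) :
    volume (closedBall (0 : ι → ℝ) r ∩ closedBall u r) =
      ∏ i, ENNReal.ofReal (2 * r - |u i|) := by
  rw [closedBall_pi _ hr, closedBall_pi _ hr, ← pi_inter_distrib, volume_pi_pi]
  refine Finset.prod_congr rfl fun i _ => ?_
  rw [Real.closedBall_eq_Icc, Real.closedBall_eq_Icc, Icc_inter_Icc, Real.volume_Icc]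
  congr 1
  simp only [Pi.zero_apply]
  rcases le_total 0 (u i) with h | h
  · rw [abs_of_nonneg h, sup_eq_right.2 (by linarith), inf_eq_left.2 (by linarith)]
    ring
  · rw [abs_of_nonpos h, sup_eq_left.2 (by linarith), inf_eq_right.2 (by linarith)]
    ring

/-- For `d > 0`, `τ > 0`, `ξ > max(1/2, τ/4)`, `z ∈ ℝⁿ` with `‖z‖_∞ ≤ d`
and `u = (z, -τd/2) ∈ ℝ^{n+1}`, the probability `q` that a uniform point of the
`(n+1)`-dimensional ℓ∞ ball `B_{n+1}^{(∞)}(ξd)` lies in `D₁ ∪ D₂`, where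
`D₁ = B_{n+1}^{(∞)}(ξd) ∩ B_{n+1}^{(∞)}(-u, ξd)` and
`D₂ = B_{n+1}^{(∞)}(ξd) ∩ B_{n+1}^{(∞)}(u, ξd)`, i.e.
`vol(D₁ ∪ D₂)/(2ξd)^{n+1}`, satisfies `q ≥ (1 - 1/(2ξ))ⁿ (1 - τ/(4ξ))`.
Here `Fin (n+1) → ℝ` carries the sup (ℓ∞) norm and `volume` is Lebesgue measure. -/
theorem stmt10 (n : ℕ) (d τ ξ : ℝ) (hd : 0 < d) (hτ : 0 < τ)
    (hξ : max (1 / 2) (τ / 4) < ξ) (z : Fin n → ℝ) (hz : ‖z‖ ≤ d) :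
    ENNReal.ofReal ((1 - 1 / (2 * ξ)) ^ n * (1 - τ / (4 * ξ))) ≤
      volume ((closedBall (0 : Fin (n + 1) → ℝ) (ξ * d) ∩
            closedBall (-(Fin.snoc z (-(τ * d) / 2))) (ξ * d)) ∪
          (closedBall (0 : Fin (n + 1) → ℝ) (ξ * d) ∩
            closedBall (Fin.snoc z (-(τ * d) / 2)) (ξ * d))) /
        ENNReal.ofReal ((2 * ξ * d) ^ (n + 1)) := by
  obtain ⟨hξ₁, hξ₂⟩ := max_lt_iff.1 hξ
  have hξ₀ : 0 < ξ := by linarith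
  have hside : 0 ≤ 2 * (ξ * d) - d := by nlinarith
  have hlast : |(-(τ * d) / 2)| = τ * d / 2 := by
    rw [neg_div, abs_neg, abs_of_pos (by positivity)]
  have hpos : 0 < (2 * ξ * d) ^ (n + 1) := by positivity
  have hbox : (1 - 1 / (2 * ξ)) ^ n * (1 - τ / (4 * ξ)) * (2 * ξ * d) ^ (n + 1) =
      (2 * (ξ * d) - d) ^ n * (2 * (ξ * d) - τ * d / 2) := by
    have h₁ : 2 * (ξ * d) - d = (1 - 1 / (2 * ξ)) * (2 * ξ * d) := by field_simp
    have h₂ : 2 * (ξ * d) - τ * d / 2 = (1 - τ / (4 * ξ)) * (2 * ξ * d) := by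
      field_simp
      ring
    rw [h₁, h₂, mul_pow _ (2 * ξ * d) n, pow_succ (2 * ξ * d) n]
    ring
  rw [ENNReal.le_div_iff_mul_le (Or.inl (by simpa using hpos)) (Or.inl ENNReal.ofReal_ne_top),
    ← ENNReal.ofReal_mul' hpos.le, hbox]
  refine le_trans ?_ (measure_mono subset_union_right)
  rw [volume_closedBall_zero_inter_closedBall_pi (by positivity), Fin.prod_univ_castSucc,
    ENNReal.ofReal_mul (by positivity), ENNReal.ofReal_pow hside]
  simp only [Fin.snoc_castSucc, Fin.snoc_last, hlast]
  gcongr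
  calc ENNReal.ofReal (2 * (ξ * d) - d) ^ n
      = ∏ _i : Fin n, ENNReal.ofReal (2 * (ξ * d) - d) := by simp
    _ ≤ ∏ i, ENNReal.ofReal (2 * (ξ * d) - |z i|) := by
      gcongr with i
      exact (norm_le_pi_norm z i).trans hz
end

section
/- Let γ ∈ (0, 1), ξ > 1/2, λ > 0 with λ approximating λ₁^{(∞)}(L) (so that λ₁^{(∞)}(L) ≤ λ ≤ (1 + 1/n)·λ₁^{(∞)}(L)), and let L ⊆ ℝⁿ be a full-rank lattice. If R′ = ((2−γ)/(1−γ))·ξλ + (γξ)/(n(1−γ)), then the number of lattice points of ℓ∞ norm at most R′ satisfies |B_n^{(∞)}(R′) ∩ L| ≤ (1 + ⌊2R′/λ₁^{(∞)}(L)⌋)ⁿ ≤ (1 + ⌊2ξ(2−γ)/(1−γ)⌋)ⁿ · 2^{o(n)}. -/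
open MeasureTheory Metric Set

/-- A set of points in `ℓ∞` space with pairwise distances at least `d` has at most
`(1 + ⌊2 * R / d⌋) ^ n` points in the closed ball of radius `R`. -/
theorem ncard_inter_closedBall_le_of_separated {n : ℕ} {S : Set (Fin n → ℝ)} {d : ℝ} (hd : 0 < d)
    (hS : ∀ x ∈ S, ∀ y ∈ S, x ≠ y → d ≤ ‖x - y‖) (R : ℝ) :
    (S ∩ closedBall 0 R).ncard ≤ (1 + ⌊2 * R / d⌋₊) ^ n := by
  have abs_le_radius {x : Fin n → ℝ} (hx : x ∈ closedBall 0 R) (i : Fin n) : |x i| ≤ R := by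
    rw [mem_closedBall_zero_iff] at hx
    exact (norm_le_pi_norm x i).trans hx
  let cell : (Fin n → ℝ) → Fin n → ℕ := fun x i => ⌊(x i + R) / d⌋₊
  let cells : Finset (Fin n → ℕ) :=
    Fintype.piFinset fun _ => Finset.range (1 + ⌊2 * R / d⌋₊)
  have hcard : (cells : Set (Fin n → ℕ)).ncard = (1 + ⌊2 * R / d⌋₊) ^ n := by
    rw [Set.ncard_coe_finset, Fintype.card_piFinset]
    simp
  rw [← hcard]
  refine Set.ncard_le_ncard_of_injOn cell ?_ ?_ cells.finite_toSet
  · rintro x ⟨-, hx⟩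
    simp only [cells, cell, Finset.mem_coe, Fintype.mem_piFinset, Finset.mem_range]
    intro i
    have hi := abs_le.mp (abs_le_radius hx i)
    have : ⌊(x i + R) / d⌋₊ ≤ ⌊2 * R / d⌋₊ := by
      apply Nat.floor_le_floor
      gcongr
      linarith [hi.2]
    omega
  · rintro x ⟨hxS, hx⟩ y ⟨hyS, hy⟩ hxy
    by_contra hne
    refine (hS x hxS y hyS hne).not_gt ((pi_norm_lt_iff hd).mpr fun i => ?_)
    have hi := (abs_le.mp (abs_le_radius hx i)).1
    have hj := (abs_le.mp (abs_le_radius hy i)).1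
    have hk : ⌊(x i + R) / d⌋₊ = ⌊(y i + R) / d⌋₊ := congrFun hxy i
    have hx0 : 0 ≤ (x i + R) / d := div_nonneg (by linarith) hd.le
    have hy0 : 0 ≤ (y i + R) / d := div_nonneg (by linarith) hd.le
    have hx1 := Nat.floor_le hx0
    have hx2 := Nat.lt_floor_add_one ((x i + R) / d)
    have hy1 := Nat.floor_le hy0
    have hy2 := Nat.lt_floor_add_one ((y i + R) / d)
    rw [hk] at hx1 hx2
    have hdist : |(x i + R) / d - (y i + R) / d| < 1 := by
      rw [abs_lt]
      constructor <;> linarith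
    rw [← sub_div, abs_div, abs_of_pos hd, div_lt_one hd, add_sub_add_right_eq_sub] at hdist
    exact hdist

/-- The floor of `a + C / n` is eventually at most the floor of `a`. -/
theorem exists_forall_floor_add_div_le (a C : ℝ) :
    ∃ N : ℕ, ∀ n : ℕ, N ≤ n → ⌊a + C / n⌋₊ ≤ ⌊a⌋₊ := by
  have hlim : Filter.Tendsto (fun n : ℕ => a + C / n) Filter.atTop (nhds a) := by
    simpa using (tendsto_const_div_atTop_nhds_zero_nat C).const_add a
  obtain ⟨N, hN⟩ := Filter.eventually_atTop.mp
    (hlim.eventually_lt_const (Nat.lt_floor_add_one a))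
  refine ⟨N, fun n hn => Nat.lt_succ_iff.mp ?_⟩
  rw [Nat.floor_lt' (Nat.succ_ne_zero _)]
  exact_mod_cast hN n hn

/-- Let `γ ∈ (0,1)`, `ξ > 1/2`. For a full-rank lattice `L ⊆ ℝⁿ`
(normalized, as in the paper, so that `2 ≤ λ₁^{(∞)}(L) < 3`), with
`λ₁^{(∞)}(L) ≤ λ ≤ (1 + 1/n) λ₁^{(∞)}(L)` and
`R' = ((2-γ)/(1-γ)) ξλ + γξ/(n(1-γ))`, the number of lattice points of ℓ∞ norm at
most `R'` satisfies `|B_n^{(∞)}(R') ∩ L| ≤ (1 + ⌊2R'/λ₁⌋)ⁿ ≤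
(1 + ⌊2ξ(2-γ)/(1-γ)⌋)ⁿ · 2^{o(n)}`; the `2^{o(n)}` factor is formalized by the
quantifier structure: for every `ε > 0` there is `N` such that for all `n ≥ N` the
second bound holds with factor `2^{εn}`.
Here `Fin n → ℝ` carries the sup (ℓ∞) norm. -/
theorem stmt17 (γ ξ : ℝ) (hγ0 : 0 < γ) (hγ1 : γ < 1) (hξ : 1 / 2 < ξ) :
    ∀ ε > (0 : ℝ), ∃ N : ℕ, ∀ n : ℕ, N ≤ n → 1 ≤ n →
      ∀ b : Fin n → (Fin n → ℝ), LinearIndependent ℝ b →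
      ∀ L : Set (Fin n → ℝ), L = {v | ∃ c : Fin n → ℤ, v = ∑ i, (c i : ℝ) • b i} →
      ∀ lam1 lam : ℝ, IsLeast {x : ℝ | ∃ v ∈ L, v ≠ 0 ∧ ‖v‖ = x} lam1 →
      2 ≤ lam1 → lam1 < 3 →
      lam1 ≤ lam → lam ≤ (1 + 1 / n) * lam1 →
      ∀ R' : ℝ, R' = (2 - γ) / (1 - γ) * (ξ * lam) + γ * ξ / (n * (1 - γ)) →
      (L ∩ closedBall 0 R').ncard ≤ (1 + ⌊2 * R' / lam1⌋₊) ^ n ∧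
      ((1 + ⌊2 * R' / lam1⌋₊ : ℕ) : ℝ) ^ n ≤
        ((1 + ⌊2 * ξ * (2 - γ) / (1 - γ)⌋₊ : ℕ) : ℝ) ^ n * (2 : ℝ) ^ (ε * n) := by
  intro ε hε
  have hγ : 0 < 1 - γ := sub_pos.mpr hγ1
  have hξ0 : 0 < ξ := by linarith
  obtain ⟨N, hN⟩ := exists_forall_floor_add_div_le (2 * ξ * (2 - γ) / (1 - γ))
    (2 * ξ * (2 - γ) / (1 - γ) + γ * ξ / (1 - γ))
  refine ⟨N, fun n hNn hn b _ L hL lam1 lam hmin h2 _ _ hlam R' hR' => ⟨?_, ?_⟩⟩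
  · refine ncard_inter_closedBall_le_of_separated (by linarith) ?_ R'
    intro x hx y hy hxy
    refine hmin.2 ⟨x - y, ?_, sub_ne_zero.mpr hxy, rfl⟩
    subst hL
    obtain ⟨c, rfl⟩ := hx
    obtain ⟨e, rfl⟩ := hy
    exact ⟨c - e, by simp [sub_smul, Finset.sum_sub_distrib]⟩
  · have hn0 : (0 : ℝ) < n := by exact_mod_cast hn
    have hl0 : 0 < lam1 := by linarith
    have hbound : 2 * R' / lam1 ≤ 2 * ξ * (2 - γ) / (1 - γ) +
        (2 * ξ * (2 - γ) / (1 - γ) + γ * ξ / (1 - γ)) / n := by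
      rw [div_le_iff₀ hl0, hR']
      have hmain : (2 - γ) / (1 - γ) * (ξ * lam) ≤
          (2 - γ) / (1 - γ) * (ξ * ((1 + 1 / n) * lam1)) := by
        have : 0 ≤ (2 - γ) / (1 - γ) := div_nonneg (by linarith) hγ.le
        gcongr
      have herr : γ * ξ / (n * (1 - γ)) * 2 ≤ γ * ξ / (n * (1 - γ)) * lam1 := by
        gcongr
      calc 2 * ((2 - γ) / (1 - γ) * (ξ * lam) + γ * ξ / (n * (1 - γ)))
          ≤ 2 * ((2 - γ) / (1 - γ) * (ξ * ((1 + 1 / n) * lam1))) +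
            γ * ξ / (n * (1 - γ)) * lam1 := by linarith
        _ = _ := by
          field_simp
          ring
    have hfloor : ⌊2 * R' / lam1⌋₊ ≤ ⌊2 * ξ * (2 - γ) / (1 - γ)⌋₊ :=
      (Nat.floor_le_floor hbound).trans (hN n hNn)
    have hpow : (1 : ℝ) ≤ 2 ^ (ε * n) :=
      Real.one_le_rpow one_le_two (by positivity)
    calc ((1 + ⌊2 * R' / lam1⌋₊ : ℕ) : ℝ) ^ n
        ≤ ((1 + ⌊2 * ξ * (2 - γ) / (1 - γ)⌋₊ : ℕ) : ℝ) ^ n := by gcongr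
      _ ≤ _ := le_mul_of_one_le_right (by positivity) hpow
end
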